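/- If (μ, ν, σ) is a regular triple of standard Weyl pairs, then the linear map V_{(μ,ν)} ⊗ V_{(μν,σ)} → Hom(ℂ^N, ℂ^N⊗ℂ^N⊗ℂ^N) sending f ⊗ g to (f⊗Id_{ℂ^N})∘g, and the linear map V_{(μ,νσ)} ⊗ V_{(ν,σ)} → Hom(ℂ^N, ℂ^N⊗ℂ^N⊗ℂ^N) sending f ⊗ g to (Id_{ℂ^N}⊗g)∘f, are both injective and have the same image, namely the space of linear maps F : ℂ^N → ℂ^N⊗ℂ^N⊗ℂ^N satisfying F∘X_{μνσ} = (X_μ⊗X_ν⊗X_σ)∘F and F∘Y_{μνσ} = (X_μ^{-1}⊗X_ν^{-1}⊗Y_σ + X_μ^{-1}⊗Y_ν⊗Id + Y_μ⊗Id⊗Id)∘F. -/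

import Mathlib

open TensorProduct

noncomputable section

/-- ℂ^N: functions from ℤ/Nℤ to ℂ. -/
abbrev CN (N : ℕ) := ZMod N → ℂ

/-- The operator A with A e_k = q^{2k} e_k. -/
def opA (q : ℂ) (N : ℕ) : Module.End ℂ (CN N) where
  toFun f := fun k => q ^ (2 * k.val) * f k
  map_add' f g := by funext k; simp [mul_add]
  map_smul' c f := by funext k; simp [smul_eq_mul]; ring

/-- The operator B with B e_k = e_{k+1}. -/
def opB (N : ℕ) : Module.End ℂ (CN N) where
  toFun f := fun k => f (k - 1)
  map_add' f g := by funext k; simp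
  map_smul' c f := by funext k; simp

/-- The operator C with C e_k = q^{1-2k} e_{k-1}, i.e. (C f)(k) = q^{-1-2k} f(k+1). -/
def opC (q : ℂ) (N : ℕ) : Module.End ℂ (CN N) where
  toFun f := fun k => q ^ (-1 - 2 * (k.val : ℤ)) * f (k + 1)
  map_add' f g := by funext k; simp [mul_add]
  map_smul' c f := by funext k; simp [smul_eq_mul]; ring

/-- A Weyl pair: invertible endomorphisms with X Y = q² Y X. -/
def IsWeylPair (q : ℂ) {V : Type*} [AddCommMonoid V] [Module ℂ V]
    (X Y : Module.End ℂ V) : Prop :=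
  IsUnit X ∧ IsUnit Y ∧ X * Y = q ^ 2 • (Y * X)

/-- A subspace invariant under both X and Y. -/
def WeylInvariant {V : Type*} [AddCommMonoid V] [Module ℂ V]
    (X Y : Module.End ℂ V) (W : Submodule ℂ V) : Prop :=
  (∀ v ∈ W, X v ∈ W) ∧ (∀ v ∈ W, Y v ∈ W)

/-- An irreducible Weyl pair. -/
def IsIrreducibleWeylPair (q : ℂ) {V : Type*} [AddCommMonoid V] [Module ℂ V]
    (X Y : Module.End ℂ V) : Prop :=
  IsWeylPair q X Y ∧ Nontrivial V ∧
    ∀ W : Submodule ℂ V, WeylInvariant X Y W → W = ⊥ ∨ W = ⊤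
/-- The Clebsch–Gordan space of a pair of Weyl pairs: all linear maps
f : ℂ^N → ℂ^N ⊗ ℂ^N with f∘X_{αβ} = (X_α⊗X_β)∘f and
f∘Y_{αβ} = (X_α⁻¹⊗Y_β + Y_α⊗Id)∘f. -/
def CGsub (N : ℕ) (Xa Ya Xb Yb Xab Yab : Module.End ℂ (CN N)) :
    Submodule ℂ (CN N →ₗ[ℂ] (CN N ⊗[ℂ] CN N)) where
  carrier := {f | f ∘ₗ Xab = (TensorProduct.map Xa Xb) ∘ₗ f ∧
    f ∘ₗ Yab = (TensorProduct.map (Ring.inverse Xa) Yb + TensorProduct.map Ya 1) ∘ₗ f}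
  add_mem' := by
    rintro f g ⟨hf1, hf2⟩ ⟨hg1, hg2⟩
    constructor <;> simp only [LinearMap.add_comp, LinearMap.comp_add, hf1, hf2, hg1, hg2]
  zero_mem' := by constructor <;> simp
  smul_mem' := by
    rintro c f ⟨hf1, hf2⟩
    constructor <;> simp only [LinearMap.smul_comp, LinearMap.comp_smul, hf1, hf2]

/-- The space of linear maps ℂ^N → ℂ^N ⊗ ℂ^N ⊗ ℂ^N intertwining the Weyl pair
(Xp, Yp) with the triple tensor operators of (Xμ,Yμ), (Xν,Yν), (Xσ,Yσ). -/
def CG3sub (N : ℕ) (Xμ Yμ Xν Yν Xσ Yσ Xp Yp : Module.End ℂ (CN N)) :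
    Submodule ℂ (CN N →ₗ[ℂ] (CN N ⊗[ℂ] (CN N ⊗[ℂ] CN N))) where
  carrier := {F | F ∘ₗ Xp = (TensorProduct.map Xμ (TensorProduct.map Xν Xσ)) ∘ₗ F ∧
    F ∘ₗ Yp = (TensorProduct.map (Ring.inverse Xμ) (TensorProduct.map (Ring.inverse Xν) Yσ)
      + TensorProduct.map (Ring.inverse Xμ) (TensorProduct.map Yν 1)
      + TensorProduct.map Yμ 1) ∘ₗ F}
  add_mem' := by
    rintro f g ⟨hf1, hf2⟩ ⟨hg1, hg2⟩
    constructor <;> simp only [LinearMap.add_comp, LinearMap.comp_add, hf1, hf2, hg1, hg2]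
  zero_mem' := by constructor <;> simp
  smul_mem' := by
    rintro c f ⟨hf1, hf2⟩
    constructor <;> simp only [LinearMap.smul_comp, LinearMap.comp_smul, hf1, hf2]

/-- The bilinear map (f, g) ↦ assoc ∘ (f ⊗ Id) ∘ g, f ⊗ g acting as
w ↦ (f ⊗ Id_{ℂ^N})(g(w)) ∈ ℂ^N ⊗ ℂ^N ⊗ ℂ^N. -/
def phiRaw (N : ℕ) :
    (CN N →ₗ[ℂ] CN N ⊗[ℂ] CN N) →ₗ[ℂ] (CN N →ₗ[ℂ] CN N ⊗[ℂ] CN N) →ₗ[ℂ]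
      (CN N →ₗ[ℂ] CN N ⊗[ℂ] (CN N ⊗[ℂ] CN N)) :=
  LinearMap.mk₂ ℂ
    (fun f g => (TensorProduct.assoc ℂ (CN N) (CN N) (CN N)).toLinearMap ∘ₗ
      (TensorProduct.map f LinearMap.id) ∘ₗ g)
    (fun f f' g => by
      simp only [TensorProduct.map_add_left, LinearMap.add_comp, LinearMap.comp_add])
    (fun c f g => by
      simp only [TensorProduct.map_smul_left, LinearMap.smul_comp, LinearMap.comp_smul])
    (fun f g g' => by
      simp only [LinearMap.comp_add])
    (fun c f g => by
      simp only [LinearMap.comp_smul])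

/-- The bilinear map (f, g) ↦ (Id ⊗ g) ∘ f, f ⊗ g acting as
w ↦ (Id_{ℂ^N} ⊗ g)(f(w)) ∈ ℂ^N ⊗ ℂ^N ⊗ ℂ^N. -/
def psiRaw (N : ℕ) :
    (CN N →ₗ[ℂ] CN N ⊗[ℂ] CN N) →ₗ[ℂ] (CN N →ₗ[ℂ] CN N ⊗[ℂ] CN N) →ₗ[ℂ]
      (CN N →ₗ[ℂ] CN N ⊗[ℂ] (CN N ⊗[ℂ] CN N)) :=
  LinearMap.mk₂ ℂ
    (fun f g => (TensorProduct.map LinearMap.id g) ∘ₗ f)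
    (fun f f' g => by simp only [LinearMap.comp_add])
    (fun c f g => by simp only [LinearMap.comp_smul])
    (fun f g g' => by
      simp only [TensorProduct.map_add_right, LinearMap.add_comp])
    (fun c f g => by
      simp only [TensorProduct.map_smul_right, LinearMap.smul_comp])

/-- The linear map V_{(μ,ν)} ⊗ V_{(μν,σ)} → Hom(ℂ^N, ℂ^N⊗ℂ^N⊗ℂ^N),
f ⊗ g ↦ (f⊗Id)∘g. -/
def phiL (N : ℕ) (CG1 CG2 : Submodule ℂ (CN N →ₗ[ℂ] CN N ⊗[ℂ] CN N)) :
    (CG1 ⊗[ℂ] CG2) →ₗ[ℂ] (CN N →ₗ[ℂ] CN N ⊗[ℂ] (CN N ⊗[ℂ] CN N)) :=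
  TensorProduct.lift (((phiRaw N).comp CG1.subtype).compl₂ CG2.subtype)

/-- The linear map V_{(μ,νσ)} ⊗ V_{(ν,σ)} → Hom(ℂ^N, ℂ^N⊗ℂ^N⊗ℂ^N),
f ⊗ g ↦ (Id⊗g)∘f. -/
def psiL (N : ℕ) (CG1 CG2 : Submodule ℂ (CN N →ₗ[ℂ] CN N ⊗[ℂ] CN N)) :
    (CG1 ⊗[ℂ] CG2) →ₗ[ℂ] (CN N →ₗ[ℂ] CN N ⊗[ℂ] (CN N ⊗[ℂ] CN N)) :=
  TensorProduct.lift (((psiRaw N).comp CG1.subtype).compl₂ CG2.subtype)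

def gb (z : ℂ) : ℕ → ℕ → ℂ
  | 0, 0 => 1
  | 0, _+1 => 0
  | n+1, 0 => gb z n 0
  | n+1, k+1 => gb z n k + z^(k+1) * gb z n (k+1)

lemma gb_zero (z : ℂ) (n : ℕ) : gb z n 0 = 1 := by
  induction n with
  | zero => rfl
  | succ n ih => simpa [gb] using ih

lemma gb_gt (z : ℂ) (n : ℕ) : ∀ k, n < k → gb z n k = 0 := by
  induction n with
  | zero => intro k hk; obtain ⟨k, rfl⟩ := Nat.exists_eq_succ_of_ne_zero hk.ne'; rfl
  | succ n ih =>
    intro k hk; obtain ⟨k, rfl⟩ := Nat.exists_eq_succ_of_ne_zero (by omega : k ≠ 0)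
    simp [gb, ih k (by omega), ih (k+1) (by omega)]

lemma gb_self (z : ℂ) (n : ℕ) : gb z n n = 1 := by
  induction n with
  | zero => rfl
  | succ n ih => simp [gb, ih, gb_gt z n (n+1) (by omega)]

lemma gb_abs (z : ℂ) (n : ℕ) : ∀ k, z^k * ((1 - z^(k+1)) * gb z n (k+1)) = (z^k - z^n) * gb z n k := by
  induction n with
  | zero => intro k; cases k <;> simp [gb]
  | succ n ih =>
    intro k
    cases k with
    | zero =>
      have := ih 0
      simp only [gb, gb_zero] at this ⊢
      linear_combination z * this
    | succ k =>
      have h1 := ih k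
      have h2 := ih (k+1)
      simp only [gb]
      linear_combination z * h1 + z^(k+2) * h2

lemma gb_van {z : ℂ} {N : ℕ} (hz : IsPrimitiveRoot z N) (hN : 1 ≤ N) :
    ∀ k, k + 1 < N → gb z N (k+1) = 0 := by
  have hz0 : z ≠ 0 := hz.ne_zero (by omega)
  intro k
  induction k with
  | zero =>
    intro h
    have := gb_abs z N 0
    simp [hz.pow_eq_one] at this
    rcases this with h1 | h1
    · exact absurd (by linear_combination -h1) (hz.ne_one h)
    · simpa using h1
  | succ k ih =>
    intro h
    have := gb_abs z N (k+1)
    rw [ih (by omega)] at this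
    simp [hz0] at this
    rcases this with h1 | h1
    · exact absurd (by linear_combination -h1) (hz.pow_ne_one_of_pos_of_lt (by omega) h)
    · simpa using h1

lemma qcomm_pow {R : Type*} [Ring R] [Algebra ℂ R] {z : ℂ} {P Q : R} (h : P * Q = z • (Q * P)) (k : ℕ) :
    P * Q^k = z^k • (Q^k * P) := by
  induction k with
  | zero => simp
  | succ k ih =>
    rw [pow_succ, ← mul_assoc, ih, smul_mul_assoc, mul_assoc, h, mul_smul_comm, smul_smul, mul_assoc, ← pow_succ]

lemma gb_binom {R : Type*} [Ring R] [Algebra ℂ R] {z : ℂ} {P Q : R} (h : P * Q = z • (Q * P)) (n : ℕ) :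
    (P + Q)^n = ∑ k ∈ Finset.range (n+1), gb z n k • (Q^k * P^(n-k)) := by
  induction n with
  | zero => simp [gb]
  | succ n ih =>
    have e1 : P * ∑ k ∈ Finset.range (n+1), gb z n k • (Q^k * P^(n-k))
        = ∑ k ∈ Finset.range (n+2), (z^k * gb z n k) • (Q^k * P^(n+1-k)) := by
      rw [Finset.sum_range_succ _ (n+1), gb_gt z n (n+1) (by omega), Finset.mul_sum]
      simp only [mul_zero, zero_smul, add_zero]
      refine Finset.sum_congr rfl fun k hk => ?_
      have : n + 1 - k = (n - k) + 1 := by have := Finset.mem_range.1 hk; omega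
      rw [this, mul_smul_comm, ← mul_assoc, qcomm_pow h, smul_mul_assoc, smul_smul, mul_assoc, ← pow_succ', mul_comm]
    have e2 : Q * ∑ k ∈ Finset.range (n+1), gb z n k • (Q^k * P^(n-k))
        = ∑ k ∈ Finset.range (n+1), gb z n k • (Q^(k+1) * P^(n+1-(k+1))) := by
      rw [Finset.mul_sum]
      refine Finset.sum_congr rfl fun k hk => ?_
      rw [mul_smul_comm, ← mul_assoc, ← pow_succ', Nat.add_sub_add_right]
    rw [pow_succ', ih, add_mul, e1, e2, Finset.sum_range_succ' _ (n+1), Finset.sum_range_succ' _ (n+1),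
      add_right_comm, ← Finset.sum_add_distrib]
    congr 1
    · refine Finset.sum_congr rfl fun k hk => ?_
      rw [← add_smul]; congr 1; simp only [gb]; ring
    · simp [gb_zero]

lemma frob {R : Type*} [Ring R] [Algebra ℂ R] {z : ℂ} {N : ℕ} (hz : IsPrimitiveRoot z N) (hN : 1 ≤ N)
    {P Q : R} (h : P * Q = z • (Q * P)) : (P + Q)^N = P^N + Q^N := by
  obtain ⟨n, rfl⟩ : ∃ n, N = n + 1 := ⟨N-1, by omega⟩
  rw [gb_binom h, Finset.sum_range_succ, Finset.sum_range_succ', Finset.sum_eq_zero]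
  · simp [gb_zero, gb_self]
  · intro k hk
    rw [gb_van hz hN k (by have := Finset.mem_range.1 hk; omega), zero_smul]

section helpers
set_option linter.unusedSectionVars false
variable {N : ℕ} [NeZero N] {q : ℂ}

lemma opA_single (k : ZMod N) :
    opA q N (Pi.single k 1) = q ^ (2 * k.val) • (Pi.single k 1 : CN N) := by
  funext j
  by_cases h : j = k
  · subst h; simp [opA]
  · simp [opA, h]

lemma opB_single (k : ZMod N) :
    opB N (Pi.single k 1) = (Pi.single (k + 1) 1 : CN N) := by
  funext j
  simp only [opB, LinearMap.coe_mk, AddHom.coe_mk, Pi.single_apply, sub_eq_iff_eq_add]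

lemma opA_pow (hq : IsPrimitiveRoot (q ^ 2) N) : (opA q N) ^ N = 1 := by
  have h : ∀ (n : ℕ) (f : CN N) (k : ZMod N), ((opA q N) ^ n) f k = (q ^ (2 * k.val)) ^ n * f k := by
    intro n
    induction n with
    | zero => intro f k; simp
    | succ n ih =>
      intro f k
      rw [pow_succ', Module.End.mul_apply]
      change q ^ (2 * k.val) * _ = _
      rw [ih]; ring
  refine LinearMap.ext fun f => funext fun k => ?_
  have e : (q ^ (2 * k.val)) ^ N = ((q ^ 2) ^ N) ^ k.val := by ring
  rw [h, e, hq.pow_eq_one]; simp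

lemma opB_pow : (opB N) ^ N = 1 := by
  have h : ∀ (n : ℕ) (f : CN N) (k : ZMod N), ((opB N) ^ n) f k = f (k - n) := by
    intro n
    induction n with
    | zero => intro f k; simp
    | succ n ih =>
      intro f k
      rw [pow_succ', Module.End.mul_apply]
      change ((opB N) ^ n) f (k - 1) = _
      rw [ih]; congr 1; push_cast; ring
  refine LinearMap.ext fun f => funext fun k => ?_
  rw [h]; simp

lemma opAB (hq : IsPrimitiveRoot (q ^ 2) N) :
    opA q N * opB N = q ^ 2 • (opB N * opA q N) := by
  refine LinearMap.ext fun f => funext fun k => ?_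
  change q ^ (2 * k.val) * f (k - 1) = q ^ 2 * (q ^ (2 * (k-1).val) * f (k - 1))
  have e : q ^ 2 * (q ^ (2 * (k-1).val) * f (k - 1)) = (q ^ 2) ^ ((k-1).val + 1) * f (k-1) := by ring
  rw [e, pow_mul]
  congr 1
  refine pow_eq_pow_of_modEq ?_ hq.pow_eq_one
  rw [← ZMod.natCast_eq_natCast_iff]
  simp

lemma inter_det {W : Type*} [AddCommGroup W] [Module ℂ W] (f : CN N →ₗ[ℂ] W) (Y' : Module.End ℂ W)
    {v : ℂ} (hv : v ≠ 0) (hf : f ∘ₗ (v • opB N) = Y' ∘ₗ f) (k : ZMod N)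
    (h : f (Pi.single k 1) = 0) : f = 0 := by
  have key : ∀ n : ℕ, f (Pi.single (k + n) 1) = 0 := by
    intro n
    induction n with
    | zero => simpa using h
    | succ n ih =>
      have := LinearMap.congr_fun hf (Pi.single (k + n) 1)
      simp only [LinearMap.comp_apply, LinearMap.smul_apply, opB_single, ih, map_zero, map_smul,
        smul_eq_zero, hv, false_or] at this
      rw [Nat.cast_succ, ← add_assoc]; exact this
  refine (Pi.basisFun ℂ (ZMod N)).ext fun j => ?_
  have := key (j - k).val
  simpa using this

lemma eig_inj (hq : IsPrimitiveRoot (q ^ 2) N) {u : ℂ} (hu : u ≠ 0) :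
    Function.Injective (fun k : ZMod N => u * q ^ (2 * k.val)) := by
  intro i j h
  have h := mul_left_cancel₀ hu h
  rw [pow_mul, pow_mul] at h
  exact ZMod.val_injective N (hq.pow_inj (ZMod.val_lt i) (ZMod.val_lt j) h)

lemma inter_inj {W : Type*} [AddCommGroup W] [Module ℂ W] (hq : IsPrimitiveRoot (q ^ 2) N)
    {u v : ℂ} (hu : u ≠ 0) (hv : v ≠ 0) (X' Y' : Module.End ℂ W) {ι : Type*} [Fintype ι]
    (b : ι → (CN N →ₗ[ℂ] W)) (hb : LinearIndependent ℂ b)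
    (hX : ∀ i, b i ∘ₗ (u • opA q N) = X' ∘ₗ b i) (hY : ∀ i, b i ∘ₗ (v • opB N) = Y' ∘ₗ b i)
    (x : ι → CN N) (hx : ∑ i, b i (x i) = 0) : x = 0 := by
  set w : ZMod N → W := fun k => ∑ i, x i k • b i (Pi.single k 1) with hw
  have hsum : ∑ k, w k = 0 := by
    rw [← hx, hw, Finset.sum_comm]
    refine Finset.sum_congr rfl fun i _ => ?_
    conv_rhs => rw [← Finset.univ_sum_single (x i), map_sum]
    refine Finset.sum_congr rfl fun k _ => ?_
    rw [← map_smul]; congr 1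
    rw [← Pi.single_smul]; simp
  have hmem : ∀ k, w k ∈ Module.End.eigenspace X' (u * q ^ (2 * k.val)) := by
    intro k
    refine Submodule.sum_mem _ fun i _ => Submodule.smul_mem _ _ ?_
    rw [Module.End.mem_eigenspace_iff]
    have := LinearMap.congr_fun (hX i) (Pi.single k 1)
    simp only [LinearMap.comp_apply, LinearMap.smul_apply, opA_single, map_smul, smul_smul] at this
    exact this.symm
  have hind := (Module.End.eigenspaces_iSupIndep X').comp (eig_inj hq hu)
  rw [iSupIndep_iff_finsetSum_eq_zero_imp_eq_zero] at hind
  have hw0 : ∀ k, w k = 0 := fun k => hind Finset.univ w (fun i _ => hmem i) hsum k (Finset.mem_univ _)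
  have hc : ∀ k, ∑ i, x i k • b i = 0 := by
    intro k
    refine inter_det _ Y' hv ?_ k ?_
    · refine LinearMap.ext fun y => ?_
      simp only [LinearMap.comp_apply, LinearMap.sum_apply, map_sum]
      refine Finset.sum_congr rfl fun i _ => ?_
      have := LinearMap.congr_fun (hY i) y
      simp only [LinearMap.comp_apply] at this
      rw [LinearMap.smul_apply (x i k), LinearMap.smul_apply (x i k), map_smul Y', this]
    · simpa [hw, LinearMap.sum_apply] using hw0 k
  funext i
  funext k
  exact Fintype.linearIndependent_iff.1 hb _ (hc k) i

lemma inter_split {W : Type*} [AddCommGroup W] [Module ℂ W] (hq : IsPrimitiveRoot (q ^ 2) N)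
    {u v : ℂ} (hu : u ≠ 0) (hv : v ≠ 0) (X' Y' : Module.End ℂ W) {ι : Type*} [Fintype ι] [DecidableEq ι]
    (b : ι → (CN N →ₗ[ℂ] W)) (hb : LinearIndependent ℂ b)
    (hX : ∀ i, b i ∘ₗ (u • opA q N) = X' ∘ₗ b i) (hY : ∀ i, b i ∘ₗ (v • opB N) = Y' ∘ₗ b i) :
    ∃ L : ι → (W →ₗ[ℂ] CN N), ∀ j i, L j ∘ₗ b i = if i = j then LinearMap.id else 0 := by
  let E : (ι → CN N) →ₗ[ℂ] W := ∑ i, b i ∘ₗ LinearMap.proj i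
  have hE : LinearMap.ker E = ⊥ := by
    rw [LinearMap.ker_eq_bot']
    intro x hx
    refine inter_inj hq hu hv X' Y' b hb hX hY x ?_
    simpa [E, LinearMap.sum_apply] using hx
  obtain ⟨g, hg⟩ := LinearMap.exists_leftInverse_of_injective E hE
  refine ⟨fun j => LinearMap.proj j ∘ₗ g, fun j i => ?_⟩
  refine LinearMap.ext fun y => ?_
  have h1 : E (Pi.single i y) = b i y := by
    simp only [E, LinearMap.sum_apply, LinearMap.comp_apply, LinearMap.proj_apply]
    rw [Finset.sum_eq_single i]
    · simp
    · intro k _ hk; simp [hk]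
    · simp
  have h2 := LinearMap.congr_fun hg (Pi.single i y)
  simp only [LinearMap.comp_apply, h1, LinearMap.id_apply] at h2
  simp only [LinearMap.comp_apply, h2, LinearMap.proj_apply]
  by_cases h : i = j
  · subst h; simp
  · simp [h]

lemma inter_card {W : Type*} [AddCommGroup W] [Module ℂ W] [Module.Finite ℂ W]
    (hq : IsPrimitiveRoot (q ^ 2) N)
    {u v : ℂ} (hu : u ≠ 0) (hv : v ≠ 0) (X' Y' : Module.End ℂ W) (H : Submodule ℂ (CN N →ₗ[ℂ] W))
    (hH : ∀ f ∈ H, f ∘ₗ (u • opA q N) = X' ∘ₗ f ∧ f ∘ₗ (v • opB N) = Y' ∘ₗ f) :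
    Module.finrank ℂ H * N ≤ Module.finrank ℂ W := by
  let b := Module.finBasis ℂ H
  have hb : LinearIndependent ℂ (fun i => (b i : CN N →ₗ[ℂ] W)) :=
    b.linearIndependent.map' H.subtype (Submodule.ker_subtype _)
  let E : (Fin (Module.finrank ℂ H) → CN N) →ₗ[ℂ] W := ∑ i, (b i : CN N →ₗ[ℂ] W) ∘ₗ LinearMap.proj i
  have hE : LinearMap.ker E = ⊥ := by
    rw [LinearMap.ker_eq_bot']
    intro x hx
    refine inter_inj hq hu hv X' Y' _ hb (fun i => (hH _ (b i).2).1) (fun i => (hH _ (b i).2).2) x ?_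
    simpa [E, LinearMap.sum_apply] using hx
  have := LinearMap.finrank_le_finrank_of_injective (LinearMap.ker_eq_bot.1 hE)
  simpa [Module.finrank_pi_fintype] using this

lemma inter_exists {W : Type*} [AddCommGroup W] [Module ℂ W]
    {u v : ℂ} (hv : v ≠ 0) (X' Y' : Module.End ℂ W)
    (hXY : X' * Y' = q ^ 2 • (Y' * X')) (hYN : Y' ^ N = v ^ N • 1) (w : W) (hw : X' w = u • w) :
    ∃ f : CN N →ₗ[ℂ] W, (f ∘ₗ (u • opA q N) = X' ∘ₗ f ∧ f ∘ₗ (v • opB N) = Y' ∘ₗ f) ∧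
      f (Pi.single 0 1) = w := by
  have hper : ∀ n : ℕ, ((v⁻¹) ^ (n % N)) • (Y' ^ (n % N)) w = ((v⁻¹) ^ n) • (Y' ^ n) w := by
    intro n
    conv_rhs => rw [← Nat.mod_add_div n N, pow_add, pow_add, pow_mul Y', hYN, smul_pow, one_pow, mul_smul_comm, mul_one,
      LinearMap.smul_apply, smul_smul, mul_assoc, pow_mul, ← mul_pow, ← mul_pow, inv_mul_cancel₀ hv]
    simp
  let f : CN N →ₗ[ℂ] W := (Pi.basisFun ℂ (ZMod N)).constr ℂ
    (fun k => ((v⁻¹) ^ k.val) • (Y' ^ k.val) w)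
  have hf : ∀ k, f (Pi.single k 1) = ((v⁻¹) ^ k.val) • (Y' ^ k.val) w := by
    intro k
    have := (Pi.basisFun ℂ (ZMod N)).constr_basis ℂ (fun k => ((v⁻¹) ^ k.val) • (Y' ^ k.val) w) k
    rwa [Pi.basisFun_apply] at this
  refine ⟨f, ⟨?_, ?_⟩, ?_⟩
  · refine (Pi.basisFun ℂ (ZMod N)).ext fun k => ?_
    have := LinearMap.congr_fun (qcomm_pow hXY k.val) w
    simp only [Module.End.mul_apply, LinearMap.smul_apply, hw, map_smul] at this
    simp only [Pi.basisFun_apply, LinearMap.comp_apply, LinearMap.smul_apply, opA_single, map_smul, hf, this, smul_smul,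
      pow_mul]
    congr 1; ring
  · refine (Pi.basisFun ℂ (ZMod N)).ext fun k => ?_
    simp only [Pi.basisFun_apply, LinearMap.comp_apply, LinearMap.smul_apply, opB_single, map_smul, hf]
    have : (k + 1).val = (k.val + 1) % N := by
      rw [← ZMod.val_natCast]; congr 1; simp
    rw [this, hper, smul_smul, pow_succ', ← mul_assoc, mul_inv_cancel₀ hv, one_mul, pow_succ', Module.End.mul_apply]
  · rw [hf]; simp

lemma inv_spec (hq : IsPrimitiveRoot (q ^ 2) N) {u : ℂ} (hu : u ≠ 0) :
    Ring.inverse (u • opA q N) * (u • opA q N) = 1 ∧ (u • opA q N) * Ring.inverse (u • opA q N) = 1 := by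
  have hA : IsUnit (opA q N) := IsUnit.of_pow_eq_one (opA_pow hq) (NeZero.ne N)
  have hX : IsUnit (u • opA q N) := by
    have := (IsUnit.mk0 u hu).map (algebraMap ℂ (Module.End ℂ (CN N)))
    rw [Algebra.smul_def]
    exact this.mul hA
  exact ⟨Ring.inverse_mul_cancel _ hX, Ring.mul_inverse_cancel _ hX⟩

lemma pair_rel {V : Type*} [AddCommGroup V] [Module ℂ V] (hq : IsPrimitiveRoot (q ^ 2) N)
    {X Y R X2 Y2 : Module.End ℂ V} (h1 : R * X = 1) (h2 : X * R = 1)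
    (hXY : X * Y = q ^ 2 • (Y * X)) (hXY2 : X2 * Y2 = q ^ 2 • (Y2 * X2)) {x y y2 : ℂ} (hx : x ≠ 0)
    (hX : X ^ N = x • 1) (hY : Y ^ N = y • 1) (hY2 : Y2 ^ N = y2 • 1) :
    TensorProduct.map X X2 * (TensorProduct.map R Y2 + TensorProduct.map Y 1)
      = q ^ 2 • ((TensorProduct.map R Y2 + TensorProduct.map Y 1) * TensorProduct.map X X2) ∧
    (TensorProduct.map R Y2 + TensorProduct.map Y 1) ^ N
      = (x⁻¹ * y2 + y) • (1 : Module.End ℂ (V ⊗[ℂ] V)) := by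
  have hN : 1 ≤ N := Nat.one_le_iff_ne_zero.2 (NeZero.ne N)
  have hq0 : q ^ 2 ≠ 0 := hq.ne_zero (NeZero.ne N)
  have hRY : R * Y = (q ^ 2)⁻¹ • (Y * R) := by
    have : R * (X * Y) * R = R * (q ^ 2 • (Y * X)) * R := by rw [hXY]
    rw [← mul_assoc, h1, one_mul, mul_smul_comm, smul_mul_assoc, mul_assoc R, mul_assoc Y, h2, mul_one] at this
    rw [this, smul_smul, inv_mul_cancel₀ hq0, one_smul]
  have hRN : R ^ N = x⁻¹ • 1 := by
    have hc : Commute R X := by rw [Commute, SemiconjBy, h1, h2]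
    have : R ^ N * X ^ N = 1 := by rw [← hc.mul_pow, h1, one_pow]
    rw [hX, mul_smul_comm, mul_one] at this
    rw [← this, smul_smul, inv_mul_cancel₀ hx, one_smul]
  constructor
  · simp only [mul_add, add_mul, ← TensorProduct.map_mul, h1, h2, hXY, hXY2, mul_one, one_mul,
      TensorProduct.map_smul_left, TensorProduct.map_smul_right, smul_add]
  · rw [frob hq.inv hN]
    · rw [TensorProduct.map_pow, TensorProduct.map_pow, hRN, hY2, hY, one_pow,
        TensorProduct.map_smul_left, TensorProduct.map_smul_right, TensorProduct.map_smul_left,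
        TensorProduct.map_one, smul_smul, ← add_smul]
    · rw [← TensorProduct.map_mul, ← TensorProduct.map_mul, hRY, mul_one, one_mul, TensorProduct.map_smul_left]

lemma std_rel (hq : IsPrimitiveRoot (q ^ 2) N) (u v : ℂ) :
    (u • opA q N) * (v • opB N) = q ^ 2 • ((v • opB N) * (u • opA q N)) := by
  rw [smul_mul_smul_comm, smul_mul_smul_comm, opAB hq, smul_comm, mul_comm u]

lemma std_pow (hq : IsPrimitiveRoot (q ^ 2) N) (u v : ℂ) :
    (u • opA q N) ^ N = u ^ N • 1 ∧ (v • opB N) ^ N = v ^ N • 1 := by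
  rw [smul_pow, smul_pow, opA_pow hq, opB_pow]; exact ⟨rfl, rfl⟩

lemma cg_card (hq : IsPrimitiveRoot (q ^ 2) N) {ua va ub vb uc vc : ℂ}
    (hua : ua ≠ 0) (hub : ub ≠ 0) (hvc : vc ≠ 0)
    (hx : uc ^ N = ua ^ N * ub ^ N) (hy : vc ^ N = (ua ^ N)⁻¹ * vb ^ N + va ^ N) :
    N ≤ Module.finrank ℂ (CGsub N (ua • opA q N) (va • opB N) (ub • opA q N) (vb • opB N)
      (uc • opA q N) (vc • opB N)) := by
  obtain ⟨r1, r2⟩ := pair_rel hq (inv_spec hq hua).1 (inv_spec hq hua).2 (std_rel hq ua va)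
    (std_rel hq ub vb) (pow_ne_zero N hua) (std_pow hq ua va).1 (std_pow hq ua va).2 (std_pow hq ub vb).2
  rw [← hy] at r2
  obtain ⟨m, hm, hmu⟩ : ∃ m < N, (q ^ 2) ^ m = uc / (ua * ub) := by
    refine hq.eq_pow_of_pow_eq_one ?_
    rw [div_pow, hx, mul_pow, div_self]
    exact mul_ne_zero (pow_ne_zero _ hua) (pow_ne_zero _ hub)
  have hmu' : uc = ua * ub * (q ^ 2) ^ m := by rw [hmu]; field_simp
  have hw : ∀ i : ZMod N, TensorProduct.map (ua • opA q N) (ub • opA q N)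
      ((Pi.single i 1 : CN N) ⊗ₜ[ℂ] (Pi.single ((m : ZMod N) - i) 1 : CN N))
      = uc • ((Pi.single i 1 : CN N) ⊗ₜ[ℂ] (Pi.single ((m : ZMod N) - i) 1 : CN N)) := by
    intro i
    rw [TensorProduct.map_tmul, LinearMap.smul_apply, LinearMap.smul_apply, opA_single, opA_single,
      smul_smul, smul_smul, TensorProduct.smul_tmul_smul]
    congr 1
    have : (q ^ 2) ^ m = (q ^ 2) ^ (i.val + ((m : ZMod N) - i).val) := by
      refine pow_eq_pow_of_modEq ?_ hq.pow_eq_one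
      rw [← ZMod.natCast_eq_natCast_iff]
      simp
    rw [hmu', this]; ring
  choose f hf hf0 using fun i => inter_exists hvc _ _ r1 r2 _ (hw i)
  have hli : LinearIndependent ℂ (fun i : ZMod N =>
      ((Pi.single i 1 : CN N) ⊗ₜ[ℂ] (Pi.single ((m : ZMod N) - i) 1 : CN N))) := by
    have := ((Pi.basisFun ℂ (ZMod N)).tensorProduct (Pi.basisFun ℂ (ZMod N))).linearIndependent.comp
      (fun i => (i, (m : ZMod N) - i)) (fun i j h => (Prod.ext_iff.1 h).1)
    have e : (⇑((Pi.basisFun ℂ (ZMod N)).tensorProduct (Pi.basisFun ℂ (ZMod N))) ∘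
        fun i => (i, (m : ZMod N) - i)) = (fun i : ZMod N =>
      ((Pi.single i 1 : CN N) ⊗ₜ[ℂ] (Pi.single ((m : ZMod N) - i) 1 : CN N))) := by
      funext i
      simp [Module.Basis.tensorProduct_apply]
    rw [e] at this
    exact this
  let F : ZMod N → CGsub N (ua • opA q N) (va • opB N) (ub • opA q N) (vb • opB N)
      (uc • opA q N) (vc • opB N) := fun i => ⟨f i, hf i⟩
  have hF : LinearIndependent ℂ F := by
    refine LinearIndependent.of_comp
      ((LinearMap.applyₗ (Pi.single 0 1 : CN N)) ∘ₗ Submodule.subtype _) ?_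
    convert hli using 1
    funext i
    exact hf0 i
  have := hF.fintype_card_le_finrank
  rwa [ZMod.card] at this

lemma inj_of_zero {A B : Type*} [AddCommMonoid A] [Module ℂ A] [AddCommMonoid B] [Module ℂ B]
    (f : A →ₗ[ℂ] B) (h : ∀ a, f a = 0 → a = 0) : Function.Injective f := by
  let _ : AddCommGroup A := Module.addCommMonoidToAddCommGroup ℂ
  let _ : AddCommGroup B := Module.addCommMonoidToAddCommGroup ℂ
  exact (injective_iff_map_eq_zero f).2 h

lemma fin_sub {T : Type*} [AddCommMonoid T] [Module ℂ T] [Module.Finite ℂ T] (H : Submodule ℂ T) :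
    Module.Finite ℂ H := by
  let _ : AddCommGroup T := Module.addCommMonoidToAddCommGroup ℂ
  infer_instance

lemma exists_fin_basis {T : Type*} [AddCommMonoid T] [Module ℂ T] [Module.Finite ℂ T] (H : Submodule ℂ T) :
    ∃ n, Nonempty (Module.Basis (Fin n) ℂ H) := by
  let _ : AddCommGroup T := Module.addCommMonoidToAddCommGroup ℂ
  exact ⟨_, ⟨Module.finBasis ℂ H⟩⟩

lemma final_step {T1 T2 T : Type*} [AddCommMonoid T1] [Module ℂ T1] [AddCommMonoid T2] [Module ℂ T2]
    [AddCommMonoid T] [Module ℂ T] [Module.Finite ℂ T1] [Module.Finite ℂ T2] [Module.Finite ℂ T]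
    (H1 : Submodule ℂ T1) (H2 : Submodule ℂ T2)
    (φ : H1 ⊗[ℂ] H2 →ₗ[ℂ] T) (hφ : Function.Injective φ) (S : Submodule ℂ T)
    (hS : LinearMap.range φ ≤ S) (hd : Module.finrank ℂ S ≤ N * N) (h1 : N ≤ Module.finrank ℂ H1)
    (h2 : N ≤ Module.finrank ℂ H2) : LinearMap.range φ = S := by
  let _ : AddCommGroup T := Module.addCommMonoidToAddCommGroup ℂ
  let _ : AddCommGroup T1 := Module.addCommMonoidToAddCommGroup ℂ
  let _ : AddCommGroup T2 := Module.addCommMonoidToAddCommGroup ℂ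
  refine Submodule.eq_of_le_of_finrank_le hS ?_
  rw [LinearMap.finrank_range_of_inj hφ, Module.finrank_tensorProduct]
  exact hd.trans (Nat.mul_le_mul h1 h2)

lemma sub_split {W : Type*} [AddCommGroup W] [Module ℂ W] [Module.Finite ℂ W]
    (hq : IsPrimitiveRoot (q ^ 2) N) {u v : ℂ} (hu : u ≠ 0) (hv : v ≠ 0)
    (X' Y' : Module.End ℂ W) (H : Submodule ℂ (CN N →ₗ[ℂ] W))
    (hH : ∀ f ∈ H, f ∘ₗ (u • opA q N) = X' ∘ₗ f ∧ f ∘ₗ (v • opB N) = Y' ∘ₗ f) :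
    ∃ n, ∃ b : Module.Basis (Fin n) ℂ H, ∃ L : Fin n → (W →ₗ[ℂ] CN N),
      ∀ j i, L j ∘ₗ (b i : CN N →ₗ[ℂ] W) = if i = j then LinearMap.id else 0 := by
  let b := Module.finBasis ℂ H
  obtain ⟨L, hL⟩ := inter_split hq hu hv X' Y' (fun i => (b i : CN N →ₗ[ℂ] W))
    (b.linearIndependent.map' H.subtype (Submodule.ker_subtype _))
    (fun i => (hH _ (b i).2).1) (fun i => (hH _ (b i).2).2)
  exact ⟨_, b, L, hL⟩

lemma phi_inj (hq : IsPrimitiveRoot (q ^ 2) N) {u v : ℂ} (hu : u ≠ 0) (hv : v ≠ 0)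
    (X' Y' : Module.End ℂ (CN N ⊗[ℂ] CN N))
    (H1 H2 : Submodule ℂ (CN N →ₗ[ℂ] CN N ⊗[ℂ] CN N))
    (hH : ∀ f ∈ H1, f ∘ₗ (u • opA q N) = X' ∘ₗ f ∧ f ∘ₗ (v • opB N) = Y' ∘ₗ f) :
    Function.Injective (phiL N H1 H2) := by
  refine inj_of_zero _ ?_
  intro t ht
  obtain ⟨n, b, L, hL⟩ := sub_split hq hu hv X' Y' H1 hH
  obtain ⟨c, rfl⟩ := TensorProduct.eq_repr_basis_left b t
  rw [Finsupp.sum_fintype _ _ (by simp)] at ht ⊢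
  have hc : ∀ j, c j = 0 := by
    intro j
    have h2 := congrArg (fun F => (TensorProduct.map (L j) LinearMap.id) ∘ₗ
      (TensorProduct.assoc ℂ (CN N) (CN N) (CN N)).symm.toLinearMap ∘ₗ F) ht
    apply Subtype.ext
    refine LinearMap.ext fun w => ?_
    have h3 := LinearMap.congr_fun h2 w
    have key : ∀ i, (TensorProduct.map (L j) LinearMap.id)
        ((TensorProduct.map (b i : CN N →ₗ[ℂ] CN N ⊗[ℂ] CN N) LinearMap.id) ((c i : CN N →ₗ[ℂ] _) w))
        = if i = j then (c i : CN N →ₗ[ℂ] CN N ⊗[ℂ] CN N) w else 0 := by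
      intro i
      rw [← LinearMap.comp_apply, ← TensorProduct.map_comp, hL]
      split_ifs <;> simp
    simp only [map_sum, phiL, TensorProduct.lift.tmul, LinearMap.comp_apply, LinearMap.sum_apply,
      LinearMap.compl₂_apply, phiRaw, LinearMap.mk₂_apply, Submodule.subtype_apply,
      LinearEquiv.coe_coe, LinearEquiv.symm_apply_apply, key, LinearMap.zero_apply, map_zero,
      Finset.sum_ite_eq', Finset.sum_ite_eq, Finset.mem_univ, if_true] at h3
    exact h3
  simp [hc]

lemma psi_inj (hq : IsPrimitiveRoot (q ^ 2) N) {u v : ℂ} (hu : u ≠ 0) (hv : v ≠ 0)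
    (X' Y' : Module.End ℂ (CN N ⊗[ℂ] CN N))
    (H1 H2 : Submodule ℂ (CN N →ₗ[ℂ] CN N ⊗[ℂ] CN N))
    (hH : ∀ f ∈ H2, f ∘ₗ (u • opA q N) = X' ∘ₗ f ∧ f ∘ₗ (v • opB N) = Y' ∘ₗ f) :
    Function.Injective (psiL N H1 H2) := by
  refine inj_of_zero _ ?_
  intro t ht
  obtain ⟨n, b, L, hL⟩ := sub_split hq hu hv X' Y' H2 hH
  obtain ⟨c, rfl⟩ := TensorProduct.eq_repr_basis_right b t
  rw [Finsupp.sum_fintype _ _ (by simp)] at ht ⊢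
  have hc : ∀ j, c j = 0 := by
    intro j
    have h2 := congrArg (fun F => (TensorProduct.map LinearMap.id (L j)) ∘ₗ F) ht
    apply Subtype.ext
    refine LinearMap.ext fun w => ?_
    have h3 := LinearMap.congr_fun h2 w
    have key : ∀ i, (TensorProduct.map LinearMap.id (L j))
        ((TensorProduct.map LinearMap.id (b i : CN N →ₗ[ℂ] CN N ⊗[ℂ] CN N)) ((c i : CN N →ₗ[ℂ] _) w))
        = if i = j then (c i : CN N →ₗ[ℂ] CN N ⊗[ℂ] CN N) w else 0 := by
      intro i
      rw [← LinearMap.comp_apply, ← TensorProduct.map_comp, hL]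
      split_ifs <;> simp
    simp only [map_sum, psiL, TensorProduct.lift.tmul, LinearMap.comp_apply, LinearMap.sum_apply,
      LinearMap.compl₂_apply, psiRaw, LinearMap.mk₂_apply, Submodule.subtype_apply,
      key, LinearMap.zero_apply, map_zero,
      Finset.sum_ite_eq', Finset.sum_ite_eq, Finset.mem_univ, if_true] at h3
    exact h3
  simp [hc]

lemma range_le_of_tmul {H1 H2 T : Type*} [AddCommMonoid H1] [Module ℂ H1] [AddCommMonoid H2] [Module ℂ H2]
    [AddCommMonoid T] [Module ℂ T] (φ : H1 ⊗[ℂ] H2 →ₗ[ℂ] T) (S : Submodule ℂ T)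
    (h : ∀ f g, φ (f ⊗ₜ g) ∈ S) : LinearMap.range φ ≤ S := by
  rintro _ ⟨t, rfl⟩
  induction t with
  | zero => simp
  | tmul f g => exact h f g
  | add a b ha hb => rw [map_add]; exact S.add_mem ha hb

lemma phi_range {X1 Y1 X2 Y2 X3 Y3 X12 Y12 X123 Y123 : Module.End ℂ (CN N)}
    (h1 : Ring.inverse X1 * X1 = 1) (h2 : Ring.inverse X2 * X2 = 1) (h12 : X12 * Ring.inverse X12 = 1) :
    LinearMap.range (phiL N (CGsub N X1 Y1 X2 Y2 X12 Y12) (CGsub N X12 Y12 X3 Y3 X123 Y123))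
      ≤ CG3sub N X1 Y1 X2 Y2 X3 Y3 X123 Y123 := by
  refine range_le_of_tmul (H1 := CGsub N X1 Y1 X2 Y2 X12 Y12) (H2 := CGsub N X12 Y12 X3 Y3 X123 Y123) _ _ ?_
  rintro ⟨f, hf1, hf2⟩ ⟨g, hg1, hg2⟩
  have hfR : f ∘ₗ Ring.inverse X12 = TensorProduct.map (Ring.inverse X1) (Ring.inverse X2) ∘ₗ f := by
    have e : f = TensorProduct.map (Ring.inverse X1) (Ring.inverse X2) ∘ₗ (f ∘ₗ X12) := by
      rw [hf1, ← LinearMap.comp_assoc, ← TensorProduct.map_comp]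
      change f = TensorProduct.map (Ring.inverse X1 * X1) (Ring.inverse X2 * X2) ∘ₗ f
      rw [h1, h2, TensorProduct.map_one]; rfl
    conv_lhs => rw [e]
    rw [LinearMap.comp_assoc, LinearMap.comp_assoc]
    change _ ∘ₗ f ∘ₗ (X12 * Ring.inverse X12) = _
    rw [h12]; rfl
  have hassoc : ∀ a b c : Module.End ℂ (CN N), (TensorProduct.assoc ℂ (CN N) (CN N) (CN N)).toLinearMap ∘ₗ
      TensorProduct.map (TensorProduct.map a b) c = TensorProduct.map a (TensorProduct.map b c) ∘ₗ
      (TensorProduct.assoc ℂ (CN N) (CN N) (CN N)).toLinearMap := by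
    intro a b c
    exact (TensorProduct.map_map_comp_assoc_eq a b c).symm
  have e : phiL N (CGsub N X1 Y1 X2 Y2 X12 Y12) (CGsub N X12 Y12 X3 Y3 X123 Y123)
      (⟨f, hf1, hf2⟩ ⊗ₜ ⟨g, hg1, hg2⟩) = (TensorProduct.assoc ℂ (CN N) (CN N) (CN N)).toLinearMap ∘ₗ
      (TensorProduct.map f LinearMap.id) ∘ₗ g := by
    simp [phiL, phiRaw]
  rw [e]
  have hf3 : ∀ (P c : Module.End ℂ (CN N)) (M : Module.End ℂ (CN N ⊗[ℂ] CN N)), f ∘ₗ P = M ∘ₗ f →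
      TensorProduct.map f LinearMap.id ∘ₗ TensorProduct.map P c
        = TensorProduct.map M c ∘ₗ TensorProduct.map f LinearMap.id := by
    intro P c M h
    rw [← TensorProduct.map_comp, ← TensorProduct.map_comp, h]; rfl
  have hone : TensorProduct.map Y1 (1 : Module.End ℂ (CN N ⊗[ℂ] CN N)) = TensorProduct.map Y1 (TensorProduct.map 1 1) := by
    rw [TensorProduct.map_one]
  constructor
  · rw [LinearMap.comp_assoc, LinearMap.comp_assoc, hg1, ← LinearMap.comp_assoc _ _ (TensorProduct.map f _),
      hf3 _ _ _ hf1, LinearMap.comp_assoc, ← LinearMap.comp_assoc _ _ (TensorProduct.assoc ℂ (CN N) (CN N) (CN N)).toLinearMap,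
      hassoc, LinearMap.comp_assoc]
  · rw [LinearMap.comp_assoc, LinearMap.comp_assoc, hg2, ← LinearMap.comp_assoc _ _ (TensorProduct.map f _),
      LinearMap.comp_add, hf3 _ _ _ hfR, hf3 _ _ _ hf2, ← LinearMap.add_comp, LinearMap.comp_assoc,
      ← LinearMap.comp_assoc _ _ (TensorProduct.assoc ℂ (CN N) (CN N) (CN N)).toLinearMap,
      TensorProduct.map_add_left, LinearMap.comp_add, LinearMap.comp_add, hassoc, hassoc, hassoc, hone,
      ← LinearMap.add_comp, ← LinearMap.add_comp, LinearMap.comp_assoc, add_assoc]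

lemma psi_range {X1 Y1 X2 Y2 X3 Y3 X23 Y23 X123 Y123 : Module.End ℂ (CN N)} :
    LinearMap.range (psiL N (CGsub N X1 Y1 X23 Y23 X123 Y123) (CGsub N X2 Y2 X3 Y3 X23 Y23))
      ≤ CG3sub N X1 Y1 X2 Y2 X3 Y3 X123 Y123 := by
  refine range_le_of_tmul (H1 := CGsub N X1 Y1 X23 Y23 X123 Y123) (H2 := CGsub N X2 Y2 X3 Y3 X23 Y23) _ _ ?_
  rintro ⟨f, hf1, hf2⟩ ⟨g, hg1, hg2⟩
  have e : psiL N (CGsub N X1 Y1 X23 Y23 X123 Y123) (CGsub N X2 Y2 X3 Y3 X23 Y23)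
      (⟨f, hf1, hf2⟩ ⊗ₜ ⟨g, hg1, hg2⟩) = (TensorProduct.map LinearMap.id g) ∘ₗ f := by
    simp [psiL, psiRaw]
  rw [e]
  have hg3 : ∀ (P c : Module.End ℂ (CN N)) (M : Module.End ℂ (CN N ⊗[ℂ] CN N)), g ∘ₗ P = M ∘ₗ g →
      TensorProduct.map LinearMap.id g ∘ₗ TensorProduct.map c P
        = TensorProduct.map c M ∘ₗ TensorProduct.map LinearMap.id g := by
    intro P c M h
    rw [← TensorProduct.map_comp, ← TensorProduct.map_comp, h]; rfl
  constructor
  · rw [LinearMap.comp_assoc, hf1, ← LinearMap.comp_assoc, hg3 _ _ _ hg1, LinearMap.comp_assoc]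
  · rw [LinearMap.comp_assoc, hf2, ← LinearMap.comp_assoc, LinearMap.comp_add, hg3 _ _ _ hg2,
      hg3 1 Y1 1 rfl, ← LinearMap.add_comp, TensorProduct.map_add_right, LinearMap.comp_assoc]

end helpers

/-- for a regular triple (μ,ν,σ), the maps
V_{(μ,ν)} ⊗ V_{(μν,σ)} → Hom(ℂ^N, ℂ^N⊗ℂ^N⊗ℂ^N), f⊗g ↦ (f⊗Id)∘g, and
V_{(μ,νσ)} ⊗ V_{(ν,σ)} → Hom(ℂ^N, ℂ^N⊗ℂ^N⊗ℂ^N), f⊗g ↦ (Id⊗g)∘f, are injective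
with the same image, namely the space of equivariant maps ℂ^N → ℂ^N⊗ℂ^N⊗ℂ^N. -/
theorem stmt10 (N : ℕ) (hN : 1 ≤ N) (q : ℂ) (hq : IsPrimitiveRoot (q ^ 2) N)
    (u1 v1 u2 v2 u3 v3 u12 v12 u23 v23 u123 v123 : ℂ)
    (hu1 : u1 ≠ 0) (hv1 : v1 ≠ 0) (hu2 : u2 ≠ 0) (hv2 : v2 ≠ 0)
    (hu3 : u3 ≠ 0) (hv3 : v3 ≠ 0) (hu12 : u12 ≠ 0) (hv12 : v12 ≠ 0)
    (hu23 : u23 ≠ 0) (hv23 : v23 ≠ 0) (hu123 : u123 ≠ 0) (hv123 : v123 ≠ 0)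
    (hreg1 : (u1 ^ N)⁻¹ * v2 ^ N + v1 ^ N ≠ 0)
    (hreg2 : (u2 ^ N)⁻¹ * v3 ^ N + v2 ^ N ≠ 0)
    (hreg3 : (u1 ^ N * u2 ^ N)⁻¹ * v3 ^ N + (u1 ^ N)⁻¹ * v2 ^ N + v1 ^ N ≠ 0)
    (hx12 : u12 ^ N = u1 ^ N * u2 ^ N) (hy12 : v12 ^ N = (u1 ^ N)⁻¹ * v2 ^ N + v1 ^ N)
    (hx23 : u23 ^ N = u2 ^ N * u3 ^ N) (hy23 : v23 ^ N = (u2 ^ N)⁻¹ * v3 ^ N + v2 ^ N)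
    (hx123 : u123 ^ N = u1 ^ N * u2 ^ N * u3 ^ N)
    (hy123 : v123 ^ N = (u1 ^ N * u2 ^ N)⁻¹ * v3 ^ N + (u1 ^ N)⁻¹ * v2 ^ N + v1 ^ N) :
    let Xμ := u1 • opA q N; let Yμ := v1 • opB N
    let Xν := u2 • opA q N; let Yν := v2 • opB N
    let Xσ := u3 • opA q N; let Yσ := v3 • opB N
    let Xμν := u12 • opA q N; let Yμν := v12 • opB N
    let Xνσ := u23 • opA q N; let Yνσ := v23 • opB N
    let Xμνσ := u123 • opA q N; let Yμνσ := v123 • opB N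
    let CG1 := CGsub N Xμ Yμ Xν Yν Xμν Yμν          -- V_{(μ,ν)}
    let CG2 := CGsub N Xμν Yμν Xσ Yσ Xμνσ Yμνσ      -- V_{(μν,σ)}
    let CG1' := CGsub N Xμ Yμ Xνσ Yνσ Xμνσ Yμνσ     -- V_{(μ,νσ)}
    let CG2' := CGsub N Xν Yν Xσ Yσ Xνσ Yνσ         -- V_{(ν,σ)}
    let S := CG3sub N Xμ Yμ Xν Yν Xσ Yσ Xμνσ Yμνσ
    Function.Injective (phiL N CG1 CG2) ∧ LinearMap.range (phiL N CG1 CG2) = S ∧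
    Function.Injective (psiL N CG1' CG2') ∧ LinearMap.range (psiL N CG1' CG2') = S := by
  intro Xμ Yμ Xν Yν Xσ Yσ Xμν Yμν Xνσ Yνσ Xμνσ Yμνσ CG1 CG2 CG1' CG2' S
  have : NeZero N := ⟨by omega⟩
  have hS : Module.finrank ℂ S ≤ N * N := by
    have := inter_card hq hu123 hv123 _ _ S (fun f hf => hf)
    simp only [Module.finrank_tensorProduct, Module.finrank_fintype_fun_eq_card, ZMod.card] at this
    rw [← mul_assoc] at this
    exact Nat.le_of_mul_le_mul_right this (by omega)
  have i1 : Function.Injective (phiL N CG1 CG2) :=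
    phi_inj hq hu12 hv12 _ _ CG1 CG2 (fun f hf => hf)
  have i2 : Function.Injective (psiL N CG1' CG2') :=
    psi_inj hq hu23 hv23 _ _ CG1' CG2' (fun f hf => hf)
  refine ⟨i1, ?_, i2, ?_⟩
  · refine final_step CG1 CG2 _ i1 S ?_ hS ?_ ?_
    · exact phi_range (inv_spec hq hu1).1 (inv_spec hq hu2).1 (inv_spec hq hu12).2
    · exact cg_card hq hu1 hu2 hv12 hx12 hy12
    · refine cg_card hq hu12 hu3 hv123 ?_ ?_
      · rw [hx123, hx12]
      · rw [hy123, hx12, hy12]; ring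
  · refine final_step CG1' CG2' _ i2 S ?_ hS ?_ ?_
    · exact psi_range
    · refine cg_card hq hu1 hu23 hv123 ?_ ?_
      · rw [hx123, hx23]; ring
      · rw [hy123, hy23, mul_inv]; ring
    · exact cg_card hq hu2 hu3 hv23 hx23 hy23

end
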